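/- arXiv:2410.20312 — 2 statements merged into one kernel-verified Lean document; each statement's English description precedes it below -/
import Mathlib

section
/- Let n ≥ 2, L ≥ 0, and let g : ℝ → ℝ be differentiable and L-Lipschitz. Let x : Fin n → ℝ and fix i ∈ Fin n. Then the derivative of t ↦ V(Function.update x i t) at t = x i is bounded in absolute value by (2·L²/(n(n−1)))·∑_{j ≠ i} |x i − x j|. -/
/-- The sample variance `V(x) = (1/(n-1)) ∑ i (g (x i) - (1/n) ∑ j g (x j))²` of the transformed
points `g (x i)`. -/
noncomputable def sampleVar (n : ℕ) (g : ℝ → ℝ) (x : Fin n → ℝ) : ℝ :=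
  (1 / ((n : ℝ) - 1)) * ∑ i, (g (x i) - (1 / (n : ℝ)) * ∑ j, g (x j)) ^ 2

theorem sampleVar_eq_sum_sq_sub {n : ℕ} (hn : n ≠ 0) (g : ℝ → ℝ) (x : Fin n → ℝ) :
    sampleVar n g x =
      (1 / ((n : ℝ) - 1)) * (∑ j, g (x j) ^ 2 - (1 / (n : ℝ)) * (∑ j, g (x j)) ^ 2) := by
  have hn' : (n : ℝ) ≠ 0 := Nat.cast_ne_zero.mpr hn
  unfold sampleVar
  congr 1
  simp only [sub_sq, Finset.sum_add_distrib, Finset.sum_sub_distrib, ← Finset.sum_mul,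
    ← Finset.mul_sum, Finset.sum_const, Finset.card_univ, Fintype.card_fin, nsmul_eq_mul]
  field_simp
  ring

theorem sum_comp_update {n : ℕ} (f : ℝ → ℝ) (x : Fin n → ℝ) (i : Fin n) (t : ℝ) :
    ∑ j, f (Function.update x i t j) = f t + ∑ j ∈ Finset.univ.erase i, f (x j) := by
  rw [← Finset.add_sum_erase _ _ (Finset.mem_univ i), Function.update_self]
  congr 1
  exact Finset.sum_congr rfl fun j hj => by
    rw [Function.update_of_ne (Finset.ne_of_mem_erase hj)]

theorem hasDerivAt_sampleVar_update {n : ℕ} (hn : 2 ≤ n) {g : ℝ → ℝ} (x : Fin n → ℝ) (i : Fin n)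
    (hg : DifferentiableAt ℝ g (x i)) :
    HasDerivAt (fun t : ℝ => sampleVar n g (Function.update x i t))
      (2 * deriv g (x i) / ((n : ℝ) * ((n : ℝ) - 1)) *
        ∑ j ∈ Finset.univ.erase i, (g (x i) - g (x j))) (x i) := by
  have hn2 : (2 : ℝ) ≤ n := by exact_mod_cast hn
  have hn0 : (n : ℝ) ≠ 0 := by positivity
  have hn1 : (n : ℝ) - 1 ≠ 0 := by linarith
  have hfun : (fun t : ℝ => sampleVar n g (Function.update x i t)) = fun t =>
      (1 / ((n : ℝ) - 1)) * (g t ^ 2 + ∑ j ∈ Finset.univ.erase i, g (x j) ^ 2 -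
        (1 / (n : ℝ)) * (g t + ∑ j ∈ Finset.univ.erase i, g (x j)) ^ 2) := by
    funext t
    rw [sampleVar_eq_sum_sq_sub (by lia), sum_comp_update g,
      sum_comp_update (fun y => g y ^ 2)]
  have hcard : ((Finset.univ.erase i).card : ℝ) = n - 1 := by
    rw [Finset.card_erase_of_mem (Finset.mem_univ i), Finset.card_univ, Fintype.card_fin,
      Nat.cast_pred (by lia)]
  have hd := hg.hasDerivAt
  rw [hfun]
  refine HasDerivAt.congr_deriv ((((hd.pow 2).add_const (∑ j ∈ Finset.univ.erase i, g (x j) ^ 2)).sub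
    (((hd.add_const (∑ j ∈ Finset.univ.erase i, g (x j))).pow 2).const_mul
      (1 / (n : ℝ)))).const_mul (1 / ((n : ℝ) - 1))) ?_
  rw [Finset.sum_sub_distrib, Finset.sum_const, nsmul_eq_mul, hcard]
  field_simp
  push_cast
  ring

/-- Eq. B.7 of the QDQ paper (deterministic part of Theorem 2(1)): for `n ≥ 2`, a differentiable
`L`-Lipschitz `g : ℝ → ℝ`, `x : Fin n → ℝ` and a fixed index `i`, the derivative of
`t ↦ V(update x i t)` at `t = x i` is bounded in absolute value by
`(2 L² / (n (n-1))) ∑_{j ≠ i} |x i - x j|`. -/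
theorem sampleVar_deriv_bound (n : ℕ) (hn : 2 ≤ n) (L : ℝ) (hL : 0 ≤ L) (g : ℝ → ℝ)
    (hg : Differentiable ℝ g) (hgL : LipschitzWith (Real.toNNReal L) g)
    (x : Fin n → ℝ) (i : Fin n) :
    |deriv (fun t : ℝ => sampleVar n g (Function.update x i t)) (x i)| ≤
      (2 * L ^ 2 / ((n : ℝ) * ((n : ℝ) - 1))) * ∑ j ∈ Finset.univ.erase i, |x i - x j| := by
  have hn2 : (2 : ℝ) ≤ n := by exact_mod_cast hn
  have hn1 : (0 : ℝ) < (n : ℝ) - 1 := by linarith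
  have hderiv : |deriv g (x i)| ≤ L := by
    simpa [Real.coe_toNNReal L hL] using norm_deriv_le_of_lipschitz (x₀ := x i) hgL
  have hsum : |∑ j ∈ Finset.univ.erase i, (g (x i) - g (x j))| ≤
      L * ∑ j ∈ Finset.univ.erase i, |x i - x j| := by
    rw [Finset.mul_sum]
    refine (Finset.abs_sum_le_sum_abs _ _).trans (Finset.sum_le_sum fun j _ => ?_)
    simpa [Real.dist_eq, Real.coe_toNNReal L hL] using hgL.dist_le_mul (x i) (x j)
  rw [(hasDerivAt_sampleVar_update hn x i (hg (x i))).deriv, abs_mul, abs_div, abs_mul,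
    abs_of_pos (by positivity : (0 : ℝ) < n * ((n : ℝ) - 1)), abs_two]
  calc 2 * |deriv g (x i)| / (n * ((n : ℝ) - 1)) *
        |∑ j ∈ Finset.univ.erase i, (g (x i) - g (x j))|
      ≤ 2 * L / (n * ((n : ℝ) - 1)) * (L * ∑ j ∈ Finset.univ.erase i, |x i - x j|) := by
        gcongr
    _ = 2 * L ^ 2 / (n * ((n : ℝ) - 1)) * ∑ j ∈ Finset.univ.erase i, |x i - x j| := by
        ring
end

section
/- Let S and A be nonempty measurable spaces, r : S × A → ℝ, γ ∈ (0,1), and κ a Markov kernel from S × A to S. Let α, β ∈ [0,1], U ⊆ S × A, and H : S × A → ℝ with H(x) > 0 for every x ∈ U. Let Q : S × A → ℝ be bounded by M, suppose that for every (s,a) the functions s' ↦ ⨆_{a' ∈ A} Q(s',a') and s' ↦ ⨆_{a' ∈ A} G_Q(s',a') are integrable with respect to κ(s,a), and assume the event hypothesis: for every x ∈ U, |1 − 1/H(x)|·|Q(x)| ≤ (1−β)·⨆_{y ∈ S×A} |Q(y)|. Then for every (s,a): |𝓑Q(s,a) − 𝓕Q(s,a)| ≤ γ·(1−α)·(1−β)·⨆_{x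 ∈ S×A} |Q(x)|. -/
open MeasureTheory ProbabilityTheory

open Classical in
/-- The blended (uncertainty-penalized) target of QDQ: on the high-uncertainty set `U` the
Q-value is weighted by `1/H`, and off `U` it is weighted by `β`, mixed with the unpenalized
value with weight `α`. -/
noncomputable def blendedTarget {X : Type*} (U : Set X) (H : X → ℝ) (α β : ℝ)
    (Q : X → ℝ) (x : X) : ℝ :=
  α * Q x + (1 - α) * (if x ∈ U then Q x / H x else β * Q x)

/-- The QDQ Bellman operator
`(𝓕Q)(s,a) = r(s,a) + γ ∫ (⨆ a', G_Q(s',a')) dκ(s,a)(s')`, where `G_Q` is the blended target. -/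
noncomputable def qdqBellman {S A : Type*} [MeasurableSpace S] [MeasurableSpace A]
    (r : S × A → ℝ) (γ : ℝ) (κ : Kernel (S × A) S) (U : Set (S × A)) (H : S × A → ℝ)
    (α β : ℝ) (Q : S × A → ℝ) (p : S × A) : ℝ :=
  r p + γ * ∫ s', (⨆ a' : A, blendedTarget U H α β Q (s', a')) ∂(κ p)

/-- The classical (optimal) Bellman operator
`(𝓑Q)(s,a) = r(s,a) + γ ∫ (⨆ a', Q(s',a')) dκ(s,a)(s')`. -/
noncomputable def classicalBellman {S A : Type*} [MeasurableSpace S] [MeasurableSpace A]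
    (r : S × A → ℝ) (γ : ℝ) (κ : Kernel (S × A) S) (Q : S × A → ℝ) (p : S × A) : ℝ :=
  r p + γ * ∫ s', (⨆ a' : A, Q (s', a')) ∂(κ p)

/-- Suprema of two bounded-above families that are uniformly within `C` of each other are within
`C` of each other. -/
theorem abs_ciSup_sub_ciSup_le {ι : Type*} [Nonempty ι] {f g : ι → ℝ} {C : ℝ}
    (hf : BddAbove (Set.range f)) (hg : BddAbove (Set.range g)) (h : ∀ i, |f i - g i| ≤ C) :
    |(⨆ i, f i) - ⨆ i, g i| ≤ C := by
  have hfg : (⨆ i, f i) ≤ (⨆ i, g i) + C := ciSup_le fun i => by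
    linarith [le_ciSup hg i, (abs_le.mp (h i)).2]
  have hgf : (⨆ i, g i) ≤ (⨆ i, f i) + C := ciSup_le fun i => by
    linarith [le_ciSup hf i, (abs_le.mp (h i)).1]
  exact abs_le.mpr ⟨by linarith, by linarith⟩

/-- If the penalized gap on `U` is at most `(1 - β) * K` and `|Q| ≤ K`, then `Q` and its blended
target differ by at most `(1 - α) * ((1 - β) * K)` pointwise. -/
theorem abs_sub_blendedTarget_le {X : Type*} {U : Set X} {H : X → ℝ} {α β K : ℝ} {Q : X → ℝ}
    (hα : α ≤ 1) (hβ : β ≤ 1) (hQ : ∀ x, |Q x| ≤ K)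
    (hU : ∀ x ∈ U, |1 - 1 / H x| * |Q x| ≤ (1 - β) * K) (x : X) :
    |Q x - blendedTarget U H α β Q x| ≤ (1 - α) * ((1 - β) * K) := by
  have hα' : 0 ≤ 1 - α := sub_nonneg.mpr hα
  have hβ' : 0 ≤ 1 - β := sub_nonneg.mpr hβ
  unfold blendedTarget
  split_ifs with hx
  · rw [show Q x - (α * Q x + (1 - α) * (Q x / H x)) = (1 - α) * ((1 - 1 / H x) * Q x) by ring,
      abs_mul, abs_of_nonneg hα', abs_mul]
    exact mul_le_mul_of_nonneg_left (hU x hx) hα'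
  · rw [show Q x - (α * Q x + (1 - α) * (β * Q x)) = (1 - α) * ((1 - β) * Q x) by ring,
      abs_mul, abs_of_nonneg hα', abs_mul, abs_of_nonneg hβ']
    gcongr
    exact hQ x

/-- Lemma 1 of the QDQ paper (deterministic form of the "with probability `1-η`" case): under the
event hypothesis that on the uncertainty set `U` the penalized gap does not dominate the
unpenalized gap, the classical and QDQ Bellman operators differ by at most
`γ (1-α)(1-β) ⨆ x, |Q x|` at every `(s,a)`. -/
theorem classicalBellman_sub_qdqBellman_bound {S A : Type*}
    [MeasurableSpace S] [MeasurableSpace A] [Nonempty S] [Nonempty A]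
    (r : S × A → ℝ) (γ : ℝ) (hγ : γ ∈ Set.Ioo (0 : ℝ) 1)
    (κ : Kernel (S × A) S) [IsMarkovKernel κ]
    (α β : ℝ) (hα : α ∈ Set.Icc (0 : ℝ) 1) (hβ : β ∈ Set.Icc (0 : ℝ) 1)
    (U : Set (S × A)) (H : S × A → ℝ) (hH : ∀ x ∈ U, 0 < H x)
    (Q : S × A → ℝ) (M : ℝ) (hQ : ∀ x, |Q x| ≤ M)
    (hint : ∀ p : S × A, Integrable (fun s' => ⨆ a' : A, Q (s', a')) (κ p))
    (hintG : ∀ p : S × A,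
      Integrable (fun s' => ⨆ a' : A, blendedTarget U H α β Q (s', a')) (κ p))
    (hevent : ∀ x ∈ U, |1 - 1 / H x| * |Q x| ≤ (1 - β) * ⨆ y : S × A, |Q y|) :
    ∀ p : S × A,
      |classicalBellman r γ κ Q p - qdqBellman r γ κ U H α β Q p| ≤
        γ * (1 - α) * (1 - β) * ⨆ x : S × A, |Q x| := by
  intro p
  set K := ⨆ x : S × A, |Q x|
  have hK : ∀ x, |Q x| ≤ K := le_ciSup ⟨M, Set.forall_mem_range.mpr hQ⟩
  have hgap := abs_sub_blendedTarget_le (α := α) hα.2 hβ.2 hK hevent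
  have hsup : ∀ s' : S, |(⨆ a' : A, Q (s', a')) - ⨆ a' : A, blendedTarget U H α β Q (s', a')| ≤
      (1 - α) * ((1 - β) * K) := fun s' =>
    abs_ciSup_sub_ciSup_le
      ⟨K, Set.forall_mem_range.mpr fun a' => (le_abs_self _).trans (hK (s', a'))⟩
      ⟨K + (1 - α) * ((1 - β) * K), Set.forall_mem_range.mpr fun a' => by
        linarith [(abs_le.mp (hgap (s', a'))).1, (abs_le.mp (hK (s', a'))).2]⟩
      fun a' => hgap (s', a')
  have hintegral := norm_integral_le_of_norm_le_const (μ := κ p)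
    (f := fun s' => (⨆ a' : A, Q (s', a')) - ⨆ a' : A, blendedTarget U H α β Q (s', a'))
    (Filter.Eventually.of_forall hsup)
  rw [integral_sub (hint p) (hintG p), probReal_univ, mul_one, Real.norm_eq_abs] at hintegral
  unfold classicalBellman qdqBellman
  rw [add_sub_add_left_eq_sub, ← mul_sub, abs_mul, abs_of_pos hγ.1, mul_assoc, mul_assoc]
  exact mul_le_mul_of_nonneg_left hintegral hγ.1.le
end
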